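/- arXiv:2402.15382 — 2 statements merged into one kernel-verified Lean document; each statement's English description precedes it below -/
import Mathlib

section
/- Every instance of the pseudo-linearity axiom [m]((⋀_{m≤k<n}[k]φ)→ψ) ∨ [m]((⋀_{m≤k<n}[k]ψ ∧ ψ)→φ), for m < n and arbitrary formulas φ, ψ, is valid in every hereditarily linear, stratified J_n-frame: it holds at every world under every valuation. -/
/-- Formulas of the polymodal language `L_{[<ω]}`: propositional variables,
a constant ⊤, Boolean connectives, and a modality `[m]` for each `m : ℕ`. -/
inductive Formula : Type
  | var : ℕ → Formula
  | top : Formula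
  | neg : Formula → Formula
  | and : Formula → Formula → Formula
  | or : Formula → Formula → Formula
  | imp : Formula → Formula → Formula
  | box : ℕ → Formula → Formula
  deriving DecidableEq

namespace Formula

/-- `⊥` abbreviates `¬⊤`. -/
def bot : Formula := neg top

/-- `⟨m⟩φ` abbreviates `¬[m]¬φ`. -/
def dia (m : ℕ) (φ : Formula) : Formula := neg (box m (neg φ))

/-- A formula is closed if it contains no propositional variables. -/
def Closed : Formula → Prop
  | var _ => False
  | top => True
  | neg a => Closed a
  | and a b => Closed a ∧ Closed b
  | or a b => Closed a ∧ Closed b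
  | imp a b => Closed a ∧ Closed b
  | box _ a => Closed a

/-- Membership in the language `L_{[<n]}`: all modalities `[m]` have `m < n`. -/
def InLang (n : ℕ) : Formula → Prop
  | var _ => True
  | top => True
  | neg a => InLang n a
  | and a b => InLang n a ∧ InLang n b
  | or a b => InLang n a ∧ InLang n b
  | imp a b => InLang n a ∧ InLang n b
  | box m a => m < n ∧ InLang n a

/-- Uniform substitution of formulas for propositional variables. -/
def subst (σ : ℕ → Formula) : Formula → Formula
  | var i => σ i
  | top => top
  | neg a => neg (subst σ a)
  | and a b => and (subst σ a) (subst σ b)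
  | or a b => or (subst σ a) (subst σ b)
  | imp a b => imp (subst σ a) (subst σ b)
  | box m a => box m (subst σ a)

/-- The number of occurrences of modal operators in a formula
(diamonds `⟨m⟩` are abbreviations `¬[m]¬`, so each is one box occurrence). -/
def modalCount : Formula → ℕ
  | var _ => 0
  | top => 0
  | neg a => modalCount a
  | and a b => modalCount a + modalCount b
  | or a b => modalCount a + modalCount b
  | imp a b => modalCount a + modalCount b
  | box _ a => modalCount a + 1

end Formula

/-- Conjunction of a finite list of formulas. -/
def bigConj (l : List Formula) : Formula := l.foldr Formula.and Formula.top

/-- `⋀_{m ≤ k < n} [k]φ`. -/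
def boxConj (m n : ℕ) (φ : Formula) : Formula :=
  bigConj ((List.range' m (n - m)).map fun k => Formula.box k φ)

/-- The pseudo-linearity axiom
`[m]((⋀_{m≤k<n}[k]φ) → ψ) ∨ [m]((⋀_{m≤k<n}[k]ψ ∧ ψ) → φ)`. -/
def psLin (n m : ℕ) (φ ψ : Formula) : Formula :=
  Formula.or
    (Formula.box m (Formula.imp (boxConj m n φ) ψ))
    (Formula.box m (Formula.imp (Formula.and (boxConj m n ψ) ψ) φ))

/-- A Boolean valuation of formulas respecting the Boolean connectives
(treating boxed formulas and variables as atoms). -/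
def RespectsBool (v : Formula → Bool) : Prop :=
  v Formula.top = true ∧
  (∀ a, v (Formula.neg a) = !(v a)) ∧
  (∀ a b, v (Formula.and a b) = (v a && v b)) ∧
  (∀ a b, v (Formula.or a b) = (v a || v b)) ∧
  (∀ a b, v (Formula.imp a b) = (!(v a) || v b))

/-- Propositional tautologies of the modal language. -/
def Tautology (φ : Formula) : Prop :=
  ∀ v : Formula → Bool, RespectsBool v → v φ = true

/-- Japaridze's polymodal provability logic `GLP`. -/
inductive GLP : Formula → Prop
  | taut {φ : Formula} : Tautology φ → GLP φ
  | distr (m : ℕ) (φ ψ : Formula) :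
      GLP (Formula.imp (Formula.box m (Formula.imp φ ψ))
        (Formula.imp (Formula.box m φ) (Formula.box m ψ)))
  | lob (m : ℕ) (φ : Formula) :
      GLP (Formula.imp (Formula.box m (Formula.imp (Formula.box m φ) φ)) (Formula.box m φ))
  | mono (m : ℕ) (φ : Formula) :
      GLP (Formula.imp (Formula.box m φ) (Formula.box (m + 1) φ))
  | diaMono (m : ℕ) (φ : Formula) :
      GLP (Formula.imp (Formula.dia m φ) (Formula.box (m + 1) (Formula.dia m φ)))
  | mp {φ ψ : Formula} : GLP (Formula.imp φ ψ) → GLP φ → GLP ψ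
  | nec (m : ℕ) {φ : Formula} : GLP φ → GLP (Formula.box m φ)

/-- The logic `GLP.3`: `GLP` together with the linearity axioms
`[m]([m]A → B) ∨ [m]([m]B ∧ B → A)`. -/
inductive GLP3 : Formula → Prop
  | taut {φ : Formula} : Tautology φ → GLP3 φ
  | distr (m : ℕ) (φ ψ : Formula) :
      GLP3 (Formula.imp (Formula.box m (Formula.imp φ ψ))
        (Formula.imp (Formula.box m φ) (Formula.box m ψ)))
  | lob (m : ℕ) (φ : Formula) :
      GLP3 (Formula.imp (Formula.box m (Formula.imp (Formula.box m φ) φ)) (Formula.box m φ))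
  | mono (m : ℕ) (φ : Formula) :
      GLP3 (Formula.imp (Formula.box m φ) (Formula.box (m + 1) φ))
  | diaMono (m : ℕ) (φ : Formula) :
      GLP3 (Formula.imp (Formula.dia m φ) (Formula.box (m + 1) (Formula.dia m φ)))
  | lin (m : ℕ) (A B : Formula) :
      GLP3 (Formula.or (Formula.box m (Formula.imp (Formula.box m A) B))
        (Formula.box m (Formula.imp (Formula.and (Formula.box m B) B) A)))
  | mp {φ ψ : Formula} : GLP3 (Formula.imp φ ψ) → GLP3 φ → GLP3 ψ
  | nec (m : ℕ) {φ : Formula} : GLP3 φ → GLP3 (Formula.box m φ)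

/-- The logic `GLP_n`, i.e. `GLP` restricted to the language `L_{[<n]}`. -/
inductive GLPn (n : ℕ) : Formula → Prop
  | taut {φ : Formula} : Tautology φ → Formula.InLang n φ → GLPn n φ
  | distr {m : ℕ} (hm : m < n) (φ ψ : Formula)
      (hφ : Formula.InLang n φ) (hψ : Formula.InLang n ψ) :
      GLPn n (Formula.imp (Formula.box m (Formula.imp φ ψ))
        (Formula.imp (Formula.box m φ) (Formula.box m ψ)))
  | lob {m : ℕ} (hm : m < n) (φ : Formula) (hφ : Formula.InLang n φ) :
      GLPn n (Formula.imp (Formula.box m (Formula.imp (Formula.box m φ) φ)) (Formula.box m φ))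
  | mono {m : ℕ} (hm : m + 1 < n) (φ : Formula) (hφ : Formula.InLang n φ) :
      GLPn n (Formula.imp (Formula.box m φ) (Formula.box (m + 1) φ))
  | diaMono {m : ℕ} (hm : m + 1 < n) (φ : Formula) (hφ : Formula.InLang n φ) :
      GLPn n (Formula.imp (Formula.dia m φ) (Formula.box (m + 1) (Formula.dia m φ)))
  | mp {φ ψ : Formula} : GLPn n (Formula.imp φ ψ) → GLPn n φ → GLPn n ψ
  | nec {m : ℕ} (hm : m < n) {φ : Formula} : GLPn n φ → GLPn n (Formula.box m φ)

/-- The logic `GLP_n.3`: `GLP_n` with the linearity axioms for each `m < n`. -/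
inductive GLPn3 (n : ℕ) : Formula → Prop
  | taut {φ : Formula} : Tautology φ → Formula.InLang n φ → GLPn3 n φ
  | distr {m : ℕ} (hm : m < n) (φ ψ : Formula)
      (hφ : Formula.InLang n φ) (hψ : Formula.InLang n ψ) :
      GLPn3 n (Formula.imp (Formula.box m (Formula.imp φ ψ))
        (Formula.imp (Formula.box m φ) (Formula.box m ψ)))
  | lob {m : ℕ} (hm : m < n) (φ : Formula) (hφ : Formula.InLang n φ) :
      GLPn3 n (Formula.imp (Formula.box m (Formula.imp (Formula.box m φ) φ)) (Formula.box m φ))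
  | mono {m : ℕ} (hm : m + 1 < n) (φ : Formula) (hφ : Formula.InLang n φ) :
      GLPn3 n (Formula.imp (Formula.box m φ) (Formula.box (m + 1) φ))
  | diaMono {m : ℕ} (hm : m + 1 < n) (φ : Formula) (hφ : Formula.InLang n φ) :
      GLPn3 n (Formula.imp (Formula.dia m φ) (Formula.box (m + 1) (Formula.dia m φ)))
  | lin {m : ℕ} (hm : m < n) (A B : Formula)
      (hA : Formula.InLang n A) (hB : Formula.InLang n B) :
      GLPn3 n (Formula.or (Formula.box m (Formula.imp (Formula.box m A) B))
        (Formula.box m (Formula.imp (Formula.and (Formula.box m B) B) A)))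
  | mp {φ ψ : Formula} : GLPn3 n (Formula.imp φ ψ) → GLPn3 n φ → GLPn3 n ψ
  | nec {m : ℕ} (hm : m < n) {φ : Formula} : GLPn3 n φ → GLPn3 n (Formula.box m φ)

/-- Beklemishev's logic `J_n`. -/
inductive Jn (n : ℕ) : Formula → Prop
  | taut {φ : Formula} : Tautology φ → Formula.InLang n φ → Jn n φ
  | distr {k : ℕ} (hk : k < n) (φ ψ : Formula)
      (hφ : Formula.InLang n φ) (hψ : Formula.InLang n ψ) :
      Jn n (Formula.imp (Formula.box k (Formula.imp φ ψ))
        (Formula.imp (Formula.box k φ) (Formula.box k ψ)))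
  | lob {k : ℕ} (hk : k < n) (φ : Formula) (hφ : Formula.InLang n φ) :
      Jn n (Formula.imp (Formula.box k (Formula.imp (Formula.box k φ) φ)) (Formula.box k φ))
  | trans1 {k m : ℕ} (hkm : k ≤ m) (hm : m < n) (φ : Formula) (hφ : Formula.InLang n φ) :
      Jn n (Formula.imp (Formula.box k φ) (Formula.box k (Formula.box m φ)))
  | trans2 {k m : ℕ} (hkm : k ≤ m) (hm : m < n) (φ : Formula) (hφ : Formula.InLang n φ) :
      Jn n (Formula.imp (Formula.box k φ) (Formula.box m (Formula.box k φ)))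
  | diaMono {k m : ℕ} (hkm : k < m) (hm : m < n) (φ : Formula) (hφ : Formula.InLang n φ) :
      Jn n (Formula.imp (Formula.dia k φ) (Formula.box m (Formula.dia k φ)))
  | mp {φ ψ : Formula} : Jn n (Formula.imp φ ψ) → Jn n φ → Jn n ψ
  | nec {k : ℕ} (hk : k < n) {φ : Formula} : Jn n φ → Jn n (Formula.box k φ)

/-- The logic `J_n.lin`: `J_n` together with the pseudo-linearity axioms. -/
inductive JnLin (n : ℕ) : Formula → Prop
  | taut {φ : Formula} : Tautology φ → Formula.InLang n φ → JnLin n φ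
  | distr {k : ℕ} (hk : k < n) (φ ψ : Formula)
      (hφ : Formula.InLang n φ) (hψ : Formula.InLang n ψ) :
      JnLin n (Formula.imp (Formula.box k (Formula.imp φ ψ))
        (Formula.imp (Formula.box k φ) (Formula.box k ψ)))
  | lob {k : ℕ} (hk : k < n) (φ : Formula) (hφ : Formula.InLang n φ) :
      JnLin n (Formula.imp (Formula.box k (Formula.imp (Formula.box k φ) φ)) (Formula.box k φ))
  | trans1 {k m : ℕ} (hkm : k ≤ m) (hm : m < n) (φ : Formula) (hφ : Formula.InLang n φ) :
      JnLin n (Formula.imp (Formula.box k φ) (Formula.box k (Formula.box m φ)))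
  | trans2 {k m : ℕ} (hkm : k ≤ m) (hm : m < n) (φ : Formula) (hφ : Formula.InLang n φ) :
      JnLin n (Formula.imp (Formula.box k φ) (Formula.box m (Formula.box k φ)))
  | diaMono {k m : ℕ} (hkm : k < m) (hm : m < n) (φ : Formula) (hφ : Formula.InLang n φ) :
      JnLin n (Formula.imp (Formula.dia k φ) (Formula.box m (Formula.dia k φ)))
  | lin {m : ℕ} (hm : m < n) (φ ψ : Formula)
      (hφ : Formula.InLang n φ) (hψ : Formula.InLang n ψ) :
      JnLin n (psLin n m φ ψ)
  | mp {φ ψ : Formula} : JnLin n (Formula.imp φ ψ) → JnLin n φ → JnLin n ψ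
  | nec {k : ℕ} (hk : k < n) {φ : Formula} : JnLin n φ → JnLin n (Formula.box k φ)

section Frames

variable {T : Type*}

/-- `(T, <_0, …, <_{n-1})` (encoded as `R : ℕ → T → T → Prop`, only the
relations `R i` for `i < n` being relevant) is a `J_n`-frame. -/
def IsJnFrame (n : ℕ) (R : ℕ → T → T → Prop) : Prop :=
  (∀ i < n, Irreflexive (R i)) ∧
  (∀ i < n, Transitive (R i)) ∧
  (∀ i < n, WellFounded fun a b => R i b a) ∧
  ∀ ⦃k m : ℕ⦄, k < m → m < n →
    (∀ ⦃x y z : T⦄, R m x y → R k y z → R k x z) ∧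
    (∀ ⦃x y z : T⦄, R k x y → R m y z → R k x z) ∧
    (∀ ⦃x y z : T⦄, R k x z → R m y z → R k x y)

/-- A frame is hereditarily linear if any two distinct points are comparable
by some relation `<_k`, `k < n`. -/
def HereditarilyLinear (n : ℕ) (R : ℕ → T → T → Prop) : Prop :=
  ∀ x y : T, x ≠ y → ∃ k < n, R k x y ∨ R k y x

/-- A frame is stratified if `x <_m y` and `z <_k y` imply `x <_m z` for `k < m < n`. -/
def Stratified (n : ℕ) (R : ℕ → T → T → Prop) : Prop :=
  ∀ ⦃k m : ℕ⦄, k < m → m < n → ∀ ⦃x y z : T⦄, R m x y → R k z y → R m x z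

/-- The relations `≡_k` (for `k ≤ n`): `≡_n` is identity and `≡_k` is the
equivalence relation generated by the union of `<_k` and `≡_{k+1}`.
Equivalence classes of `≡_k` are the `k`-planes. -/
def eqvRel (R : ℕ → T → T → Prop) (n : ℕ) (k : ℕ) : T → T → Prop :=
  if _ : k < n then
    Relation.EqvGen fun x y => R k x y ∨ eqvRel R n (k + 1) x y
  else Eq
termination_by n - k
decreasing_by omega

/-- Kripke satisfaction in the model `(T, R, V)`. -/
def Sat (R : ℕ → T → T → Prop) (V : ℕ → T → Prop) : T → Formula → Prop
  | w, Formula.var p => V p w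
  | _, Formula.top => True
  | w, Formula.neg a => ¬ Sat R V w a
  | w, Formula.and a b => Sat R V w a ∧ Sat R V w b
  | w, Formula.or a b => Sat R V w a ∨ Sat R V w b
  | w, Formula.imp a b => Sat R V w a → Sat R V w b
  | w, Formula.box m a => ∀ v : T, R m w v → Sat R V v a

end Frames

/-- A set of formulas is consistent with the logic `L` if no finite conjunction
of its elements has its negation provable in `L`. -/
def SetConsistent (L : Formula → Prop) (S : Set Formula) : Prop :=
  ∀ l : List Formula, (∀ φ ∈ l, φ ∈ S) → ¬ L (Formula.neg (bigConj l))

/-- A maximal `L`-consistent set of `L_{[<n]}`-formulas. -/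
def MCS (L : Formula → Prop) (n : ℕ) (S : Set Formula) : Prop :=
  (∀ φ ∈ S, Formula.InLang n φ) ∧ SetConsistent L S ∧
  ∀ S' : Set Formula, (∀ φ ∈ S', Formula.InLang n φ) → S ⊆ S' → S ≠ S' → ¬ SetConsistent L S'

/-- The canonical accessibility relation `x <_m y`. -/
def canonR (m : ℕ) (x y : Set Formula) : Prop :=
  (∀ ψ : Formula, Formula.box m ψ ∈ x → ψ ∈ y) ∧
  (∃ ψ : Formula, Formula.box m ψ ∈ y ∧ Formula.box m ψ ∉ x)

/-- A set of formulas is `k`-maximal if it contains `¬ψ ∧ ⋀_{k≤m<n}[m]ψ` for some `ψ`. -/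
def kMaximal (n k : ℕ) (S : Set Formula) : Prop :=
  ∃ ψ : Formula, Formula.and (Formula.neg ψ) (boxConj k n ψ) ∈ S

/-- A world satisfies a finite conjunction iff it satisfies every conjunct. -/
theorem sat_bigConj {T : Type*} (R : ℕ → T → T → Prop) (V : ℕ → T → Prop) (w : T)
    (l : List Formula) : Sat R V w (bigConj l) ↔ ∀ φ ∈ l, Sat R V w φ := by
  induction l with
  | nil => simp [bigConj, Sat]
  | cons a l ih =>
    rw [List.forall_mem_cons, ← ih]
    rfl

/-- A world satisfies `⋀_{m ≤ k < n} [k]φ` iff `φ` holds at all its `<_k`-successors,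
`m ≤ k < n`. -/
theorem sat_boxConj {T : Type*} (R : ℕ → T → T → Prop) (V : ℕ → T → Prop) (w : T)
    (m n : ℕ) (φ : Formula) :
    Sat R V w (boxConj m n φ) ↔ ∀ k, m ≤ k → k < n → ∀ v, R k w v → Sat R V v φ := by
  rw [boxConj, sat_bigConj, List.forall_mem_map]
  refine forall_congr' fun k => ?_
  rw [List.mem_range'_1]
  exact ⟨fun h hmk hkn => h (by omega), fun h hk => h hk.1 (by omega)⟩

/-- In a `J_n`-frame, two `<_m`-successors of a common point are not related by
`<_k` for any `k < m`. -/
theorem IsJnFrame.not_rel_of_lt {T : Type*} {n : ℕ} {R : ℕ → T → T → Prop}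
    (hJ : IsJnFrame n R) {k m : ℕ} (hkm : k < m) (hm : m < n) {w x y : T}
    (hx : R m w x) (hy : R m w y) : ¬ R k x y := by
  obtain ⟨hirr, -, -, h⟩ := hJ
  obtain ⟨h₁, -, h₃⟩ := h hkm hm
  exact fun hxy => hirr k (hkm.trans hm) w (h₁ hx (h₃ hxy hy))

/-- Every instance of the pseudo-linearity axiom is valid in every
hereditarily linear, stratified `J_n`-frame. -/
theorem psLin_valid (n m : ℕ) (hm : m < n) (φ ψ : Formula) {T : Type*}
    (R : ℕ → T → T → Prop) (hJ : IsJnFrame n R) (hHL : HereditarilyLinear n R)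
    (hStr : Stratified n R) (V : ℕ → T → Prop) (w : T) :
    Sat R V w (psLin n m φ ψ) := by
  simp only [psLin, Sat, sat_boxConj]
  by_contra! h
  obtain ⟨⟨x, hwx, hxφ, hxψ⟩, y, hwy, ⟨hyψ', hyψ⟩, hyφ⟩ := h
  obtain ⟨k, hk, hxy⟩ := hHL x y fun h => hxψ (h ▸ hyψ)
  rcases lt_or_ge k m with hkm | hmk
  · exact hxy.elim (hJ.not_rel_of_lt hkm hm hwx hwy) (hJ.not_rel_of_lt hkm hm hwy hwx)
  · exact hxy.elim (fun h => hyφ (hxφ k hmk hk y h)) fun h => hxψ (hyψ' k hmk hk x h)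
end

section
/- Let W be the set of all maximal J_n.lin-consistent sets of L_{[<n]}-formulas with the canonical relations <_0, …, <_{n-1}. Then each <_m is irreflexive, and the following hold: (1) x <_k y and x <_m z together imply y <_m z whenever m < k; (2) x <_k y <_m z implies x <_m z whenever m ≤ k; (3) x <_m y <_k z implies x <_m z whenever m ≤ k. -/
theorem RespectsBool.bigConj_eq {v : Formula → Bool} (hv : RespectsBool v) (l : List Formula) :
    v (bigConj l) = l.all v := by
  induction l with
  | nil => exact hv.1
  | cons a l ih =>
    change v (Formula.and a (bigConj l)) = _
    rw [hv.2.2.1, ih, List.all_cons]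

theorem Formula.inLang_bigConj {n : ℕ} {l : List Formula} (h : ∀ φ ∈ l, Formula.InLang n φ) :
    Formula.InLang n (bigConj l) := by
  induction l with
  | nil => trivial
  | cons a l ih =>
    exact ⟨h a (by simp), ih fun φ hφ => h φ (by simp [hφ])⟩

theorem JnLin.of_entails {n : ℕ} {φ ψ : Formula} (h : JnLin n φ) (hφ : Formula.InLang n φ)
    (hψ : Formula.InLang n ψ) (ht : Tautology (Formula.imp φ ψ)) : JnLin n ψ :=
  .mp (.taut ht ⟨hφ, hψ⟩) h

theorem JnLin.of_entails₂ {n : ℕ} {φ ψ χ : Formula} (h₁ : JnLin n φ) (h₂ : JnLin n ψ)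
    (hφ : Formula.InLang n φ) (hψ : Formula.InLang n ψ) (hχ : Formula.InLang n χ)
    (ht : Tautology (Formula.imp φ (Formula.imp ψ χ))) : JnLin n χ :=
  .mp (.mp (.taut ht ⟨hφ, hψ, hχ⟩) h₁) h₂

theorem JnLin.box_mono {n k : ℕ} (hk : k < n) {φ ψ : Formula} (hφ : Formula.InLang n φ)
    (hψ : Formula.InLang n ψ) (h : JnLin n (Formula.imp φ ψ)) :
    JnLin n (Formula.imp (Formula.box k φ) (Formula.box k ψ)) :=
  .mp (.distr hk φ ψ hφ hψ) (.nec hk h)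

theorem JnLin.contrapose {n : ℕ} {φ ψ : Formula} (hφ : Formula.InLang n φ)
    (hψ : Formula.InLang n ψ) (h : JnLin n (Formula.imp φ ψ)) :
    JnLin n (Formula.imp (Formula.neg ψ) (Formula.neg φ)) := by
  refine h.of_entails ⟨hφ, hψ⟩ ⟨hψ, hφ⟩ ?_
  rintro v ⟨-, hn, -, -, hi⟩
  simp only [hn, hi]
  cases v φ <;> cases v ψ <;> rfl

theorem JnLin.imp_trans {n : ℕ} {φ ψ χ : Formula} (hφ : Formula.InLang n φ)
    (hψ : Formula.InLang n ψ) (hχ : Formula.InLang n χ) (h₁ : JnLin n (Formula.imp φ ψ))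
    (h₂ : JnLin n (Formula.imp ψ χ)) : JnLin n (Formula.imp φ χ) := by
  refine h₁.of_entails₂ h₂ ⟨hφ, hψ⟩ ⟨hψ, hχ⟩ ⟨hφ, hχ⟩ ?_
  rintro v ⟨-, -, -, -, hi⟩
  simp only [hi]
  cases v φ <;> cases v ψ <;> cases v χ <;> rfl

/-- The variant of the axiom `⟨k⟩φ → [m]⟨k⟩φ` with `¬[k]` in place of `⟨k⟩`. -/
theorem JnLin.neg_box_imp {n k m : ℕ} (hkm : k < m) (hm : m < n) {φ : Formula}
    (hφ : Formula.InLang n φ) :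
    JnLin n (Formula.imp (Formula.neg (Formula.box k φ))
      (Formula.box m (Formula.neg (Formula.box k φ)))) := by
  have hk : k < n := hkm.trans hm
  have hφφ : Formula.InLang n (Formula.neg (Formula.neg φ)) := hφ
  have intro_dn : JnLin n (Formula.imp φ (Formula.neg (Formula.neg φ))) := by
    refine .taut ?_ ⟨hφ, hφ⟩
    rintro v ⟨-, hn, -, -, hi⟩
    simp only [hn, hi]
    cases v φ <;> rfl
  have elim_dn : JnLin n (Formula.imp (Formula.neg (Formula.neg φ)) φ) := by
    refine .taut ?_ ⟨hφ, hφ⟩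
    rintro v ⟨-, hn, -, -, hi⟩
    simp only [hn, hi]
    cases v φ <;> rfl
  have hb : Formula.InLang n (Formula.neg (Formula.box k φ)) := ⟨hk, hφ⟩
  have hd : Formula.InLang n (Formula.dia k (Formula.neg φ)) := ⟨hk, hφ⟩
  have h₁ : JnLin n (Formula.imp (Formula.neg (Formula.box k φ)) (Formula.dia k (Formula.neg φ))) :=
    .contrapose hd hb (.box_mono hk hφφ hφ elim_dn)
  have h₂ : JnLin n (Formula.imp (Formula.dia k (Formula.neg φ)) (Formula.neg (Formula.box k φ))) :=
    .contrapose hb hd (.box_mono hk hφ hφφ intro_dn)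
  have h₃ := JnLin.box_mono hm hd hb h₂
  have h₄ := JnLin.diaMono hkm hm (Formula.neg φ) hφ
  have hmb : Formula.InLang n (Formula.box m (Formula.neg (Formula.box k φ))) := ⟨hm, hb⟩
  have hmd : Formula.InLang n (Formula.box m (Formula.dia k (Formula.neg φ))) := ⟨hm, hd⟩
  exact .imp_trans hb hd hmb h₁ (.imp_trans hd hmd hmb h₄ h₃)

namespace MCS

variable {n : ℕ} {S : Set Formula}

theorem exists_imp_neg_of_notMem (hS : MCS (JnLin n) n S) {φ : Formula}
    (hφ : Formula.InLang n φ) (h : φ ∉ S) :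
    ∃ l : List Formula, (∀ ψ ∈ l, ψ ∈ S) ∧
      JnLin n (Formula.imp (bigConj l) (Formula.neg φ)) := by
  have hins : ¬ SetConsistent (JnLin n) (insert φ S) := by
    refine hS.2.2 _ ?_ (Set.subset_insert φ S) fun he => h (he ▸ Set.mem_insert φ S)
    rintro ψ (rfl | hψ)
    exacts [hφ, hS.1 ψ hψ]
  simp only [SetConsistent, not_forall, not_not] at hins
  obtain ⟨l, hl, hprov⟩ := hins
  have hmem : ∀ ψ ∈ l.filter (· ≠ φ), ψ ∈ S := by
    intro ψ hψ
    simp only [List.mem_filter, decide_eq_true_eq] at hψ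
    exact (hl ψ hψ.1).resolve_left hψ.2
  refine ⟨l.filter (· ≠ φ), hmem, hprov.of_entails ?_ ⟨?_, hφ⟩ ?_⟩
  rotate_left 2
  · intro v hv
    have hb := hv.bigConj_eq
    obtain ⟨-, hn, -, -, hi⟩ := hv
    simp only [hn, hi, hb]
    rw [Bool.not_not, Bool.or_eq_true, Bool.or_eq_true, Bool.not_eq_true', Bool.not_eq_true']
    by_contra! hc
    obtain ⟨h₁, h₂, h₃⟩ := hc
    rw [Bool.ne_false_iff, List.all_eq_true] at h₂
    refine h₁ (List.all_eq_true.2 fun ψ hψ => ?_)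
    by_cases he : ψ = φ
    · simpa [he] using h₃
    · exact h₂ ψ (by simp [hψ, he])
  · refine Formula.inLang_bigConj fun ψ hψ => ?_
    rcases hl ψ hψ with rfl | h'
    exacts [hφ, hS.1 ψ h']
  · exact Formula.inLang_bigConj fun ψ hψ => hS.1 ψ (hmem ψ hψ)

theorem mem_of_imp_bigConj (hS : MCS (JnLin n) n S) {φ : Formula} (hφ : Formula.InLang n φ)
    {l : List Formula} (hl : ∀ ψ ∈ l, ψ ∈ S) (h : JnLin n (Formula.imp (bigConj l) φ)) :
    φ ∈ S := by
  by_contra hn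
  obtain ⟨l', hl', h'⟩ := hS.exists_imp_neg_of_notMem hφ hn
  have hll : ∀ ψ ∈ l ++ l', ψ ∈ S := fun ψ hψ =>
    (List.mem_append.1 hψ).elim (hl ψ) (hl' ψ)
  have hlang {l : List Formula} (hl : ∀ ψ ∈ l, ψ ∈ S) : Formula.InLang n (bigConj l) :=
    Formula.inLang_bigConj fun ψ hψ => hS.1 ψ (hl ψ hψ)
  refine hS.2.1 (l ++ l') hll
    (h.of_entails₂ h' ⟨hlang hl, hφ⟩ ⟨hlang hl', hφ⟩ (hlang hll) ?_)
  intro v hv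
  have hb := hv.bigConj_eq
  obtain ⟨-, hn, -, -, hi⟩ := hv
  simp only [hn, hi, hb, List.all_append]
  cases l.all v <;> cases l'.all v <;> cases v φ <;> rfl

theorem mem_of_imp (hS : MCS (JnLin n) n S) {φ ψ : Formula} (hψ : Formula.InLang n ψ)
    (h : JnLin n (Formula.imp φ ψ)) (hφ : φ ∈ S) : ψ ∈ S := by
  have hφn := hS.1 φ hφ
  refine hS.mem_of_imp_bigConj hψ (l := [φ]) (by simpa using hφ)
    (.imp_trans ⟨hφn, trivial⟩ hφn hψ (.taut ?_ ⟨⟨hφn, trivial⟩, hφn⟩) h)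
  intro v hv
  have hb := hv.bigConj_eq
  obtain ⟨-, -, -, -, hi⟩ := hv
  simp [hi, hb]

theorem neg_mem (hS : MCS (JnLin n) n S) {φ : Formula} (hφ : Formula.InLang n φ)
    (h : φ ∉ S) : Formula.neg φ ∈ S :=
  have ⟨_, hl, h'⟩ := hS.exists_imp_neg_of_notMem hφ h
  hS.mem_of_imp_bigConj hφ hl h'

theorem notMem_of_neg_mem (hS : MCS (JnLin n) n S) {φ : Formula}
    (h : Formula.neg φ ∈ S) : φ ∉ S := by
  intro hφ
  have hφn := hS.1 φ hφ
  refine hS.2.1 [φ, Formula.neg φ] (by simp [hφ, h]) (.taut ?_ ⟨hφn, hφn, trivial⟩)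
  intro v hv
  have hb := hv.bigConj_eq
  obtain ⟨-, hn, -, -, -⟩ := hv
  simp [hn, hb]

end MCS

/-- Boxes of index at most `k` persist along `<_k`. -/
theorem canonR.box_mem {n m k : ℕ} (hmk : m ≤ k) (hk : k < n) {x y : Set Formula}
    (hx : MCS (JnLin n) n x) (h : canonR k x y) {φ : Formula} (hφ : Formula.box m φ ∈ x) :
    Formula.box m φ ∈ y :=
  have hl := hx.1 _ hφ
  h.1 _ (hx.mem_of_imp ⟨hk, hl⟩ (.trans2 hmk hk φ hl.2) hφ)

/-- Boxes of index less than `k` are reflected along `<_k`. -/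
theorem canonR.box_mem_of_box_mem {n m k : ℕ} (hmk : m < k) (hk : k < n) {x y : Set Formula}
    (hx : MCS (JnLin n) n x) (hy : MCS (JnLin n) n y) (h : canonR k x y) {φ : Formula}
    (hφ : Formula.box m φ ∈ y) : Formula.box m φ ∈ x := by
  by_contra hn
  have hl := hy.1 _ hφ
  have hneg : Formula.InLang n (Formula.neg (Formula.box m φ)) := hl
  exact hy.notMem_of_neg_mem
    (h.1 _ (hx.mem_of_imp ⟨hk, hneg⟩ (.neg_box_imp hmk hk hl.2) (hx.neg_mem hl hn))) hφ

/-- The canonical relations on the maximal `J_n.lin`-consistent sets are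
irreflexive and satisfy: (1) `x <_k y` and `x <_m z` imply `y <_m z` for
`m < k`; (2) `x <_k y <_m z` implies `x <_m z` for `m ≤ k`;
(3) `x <_m y <_k z` implies `x <_m z` for `m ≤ k`. -/
theorem canonical_Jframe_conditions (n : ℕ) :
    (∀ m, m < n → ∀ x : Set Formula, MCS (JnLin n) n x → ¬ canonR m x x) ∧
    (∀ m k : ℕ, m < k → k < n → ∀ x y z : Set Formula,
      MCS (JnLin n) n x → MCS (JnLin n) n y → MCS (JnLin n) n z →
      canonR k x y → canonR m x z → canonR m y z) ∧
    (∀ m k : ℕ, m ≤ k → k < n → ∀ x y z : Set Formula,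
      MCS (JnLin n) n x → MCS (JnLin n) n y → MCS (JnLin n) n z →
      canonR k x y → canonR m y z → canonR m x z) ∧
    (∀ m k : ℕ, m ≤ k → k < n → ∀ x y z : Set Formula,
      MCS (JnLin n) n x → MCS (JnLin n) n y → MCS (JnLin n) n z →
      canonR m x y → canonR k y z → canonR m x z) := by
  refine ⟨fun m _ x _ ⟨_, _, h, h'⟩ => h' h, ?_, ?_, ?_⟩
  · rintro m k hmk hk x y z hx hy - hxy ⟨hxz, ψ, hψz, hψx⟩
    exact ⟨fun φ hφ => hxz φ (hxy.box_mem_of_box_mem hmk hk hx hy hφ), ψ, hψz,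
      fun hψy => hψx (hxy.box_mem_of_box_mem hmk hk hx hy hψy)⟩
  · rintro m k hmk hk x y z hx - - hxy ⟨hyz, ψ, hψz, hψy⟩
    exact ⟨fun φ hφ => hyz φ (hxy.box_mem hmk hk hx hφ), ψ, hψz,
      fun hψx => hψy (hxy.box_mem hmk hk hx hψx)⟩
  · rintro m k hmk hk x y z hx hy - ⟨hxy, ψ, hψy, hψx⟩ hyz
    refine ⟨fun φ hφ => ?_, ψ, hyz.box_mem hmk hk hy hψy, hψx⟩
    have hl := hx.1 _ hφ
    exact hyz.1 φ (hxy _ (hx.mem_of_imp ⟨hl.1, hk, hl.2⟩ (.trans1 hmk hk φ hl.2) hφ))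
end
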